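/- arXiv:1605.04000 — 2 statements merged into one kernel-verified Lean document; each statement's English description precedes it below -/
import Mathlib

section
/- Let F be a subfield of ℝ, let A ∈ F^{m×n}, B ∈ F^{m×k}, c ∈ F^{1×n} be nonnegative matrices, let s be a positive integer, and let 𝒜(x) and 𝒢 be the matrices defined as follows: 𝒜(x) is the (m+1)×(n+k) block matrix with blocks A, B, c, and the 1×k row (x,…,x); 𝒢 is the (m+5)×(n+k+4) matrix whose top-left (m+1)×(n+k) block is 𝒜(s), whose rows m+2,…,m+5 restricted to the first n columns are zero, whose rows m+2,…,m+5 restricted to the next k columns are (1,…,1), (0,…,0), (0,…,0), (0,…,0), whose row m+1 restricted to the last 4 columns is (1,1,1,1), whose rows 1,…,m restricted to the last 4 columns are zero, and whose bottom-right 4×4 block is [[1,1,0,0],[0,1,1,0],[0,0,1,1],[1,0,0,1]]. If k = 1, then rank_{F+} 𝒢 = 4 + min { rank_{F+} 𝒜(ξ) : ξ ∈ [s−1, s] ∩ F }. -/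
/-- `A` is a sum of `k` rank-one matrices with nonnegative entries in the subfield `F` of `ℝ`. -/
def NNDecomp (F : Subfield ℝ) {m n : Type*} (A : Matrix m n ℝ) (k : ℕ) : Prop :=
  ∃ u : Fin k → m → ℝ, ∃ v : Fin k → n → ℝ,
    (∀ l i, 0 ≤ u l i ∧ u l i ∈ F) ∧ (∀ l j, 0 ≤ v l j ∧ v l j ∈ F) ∧
    A = ∑ l, Matrix.vecMulVec (u l) (v l)

/-- The nonnegative rank of `A` with respect to the subfield `F` of `ℝ`. -/
noncomputable def nnRank (F : Subfield ℝ) {m n : Type*} (A : Matrix m n ℝ) : ℕ :=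
  sInf {k | NNDecomp F A k}

/-- The (m+1) × (n+k) block matrix 𝒜(x) with blocks A, B, c and bottom-right row (x,…,x). -/
def Amat {m n k : ℕ} (A : Matrix (Fin m) (Fin n) ℝ) (B : Matrix (Fin m) (Fin k) ℝ)
    (c : Fin n → ℝ) (x : ℝ) : Matrix (Fin m ⊕ Fin 1) (Fin n ⊕ Fin k) ℝ :=
  Matrix.fromBlocks A B (Matrix.of fun _ j => c j) (Matrix.of fun _ _ => x)

def B0 : Matrix (Fin 4) (Fin 4) ℝ :=
  !![1,1,0,0;
     0,1,1,0;
     0,0,1,1;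
     1,0,0,1]

/-- The (m+5) × (n+k+4) matrix 𝒢 of Theorem pr3. -/
def Gmat {m n k : ℕ} (A : Matrix (Fin m) (Fin n) ℝ) (B : Matrix (Fin m) (Fin k) ℝ)
    (c : Fin n → ℝ) (s : ℝ) :
    Matrix ((Fin m ⊕ Fin 1) ⊕ Fin 4) ((Fin n ⊕ Fin k) ⊕ Fin 4) ℝ :=
  Matrix.fromBlocks (Amat A B c s)
    (Matrix.of fun i _ => Sum.elim (fun _ => (0 : ℝ)) (fun _ => 1) i)
    (Matrix.of fun i j => Sum.elim (fun _ => (0 : ℝ)) (fun _ => if i = 0 then 1 else 0) j)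
    B0


lemma nnd_of_fintype (F : Subfield ℝ) {m n ι : Type*} [Fintype ι] (A : Matrix m n ℝ)
    (u : ι → m → ℝ) (v : ι → n → ℝ)
    (hu : ∀ l i, 0 ≤ u l i ∧ u l i ∈ F) (hv : ∀ l j, 0 ≤ v l j ∧ v l j ∈ F)
    (h : ∀ i j, A i j = ∑ l, u l i * v l j) : NNDecomp F A (Fintype.card ι) := by
  let e := Fintype.equivFin ι
  refine ⟨fun l => u (e.symm l), fun l => v (e.symm l), fun l i => hu _ i, fun l j => hv _ j, ?_⟩
  ext i j
  rw [h i j, Matrix.sum_apply]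
  simp only [Matrix.vecMulVec_apply]
  exact (Equiv.sum_comp e.symm (fun l => u l i * v l j)).symm

lemma nnd_entry {F : Subfield ℝ} {m n : Type*} {A : Matrix m n ℝ} {k : ℕ}
    (h : NNDecomp F A k) : ∃ u : Fin k → m → ℝ, ∃ v : Fin k → n → ℝ,
    (∀ l i, 0 ≤ u l i ∧ u l i ∈ F) ∧ (∀ l j, 0 ≤ v l j ∧ v l j ∈ F) ∧
    ∀ i j, A i j = ∑ l, u l i * v l j := by
  obtain ⟨u, v, hu, hv, h⟩ := h
  refine ⟨u, v, hu, hv, fun i j => ?_⟩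
  rw [h, Matrix.sum_apply]
  simp only [Matrix.vecMulVec_apply]

lemma nnd_exists (F : Subfield ℝ) {m n : Type*} [Fintype m] (A : Matrix m n ℝ)
    (hA : ∀ i j, 0 ≤ A i j ∧ A i j ∈ F) : ∃ k, NNDecomp F A k := by
  classical
  refine ⟨_, nnd_of_fintype F A (fun l i => if l = i then 1 else 0) (fun l j => A l j) ?_ hA ?_⟩
  · intro l i
    split_ifs
    · exact ⟨zero_le_one, F.one_mem⟩
    · exact ⟨le_rfl, F.zero_mem⟩
  · intro i j
    simp

lemma amat_nonneg (F : Subfield ℝ) {m n : ℕ}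
    (A : Matrix (Fin m) (Fin n) ℝ) (B : Matrix (Fin m) (Fin 1) ℝ) (c : Fin n → ℝ)
    (hA : ∀ i j, 0 ≤ A i j ∧ A i j ∈ F) (hB : ∀ i j, 0 ≤ B i j ∧ B i j ∈ F)
    (hc : ∀ j, 0 ≤ c j ∧ c j ∈ F) (x : ℝ) (hx : 0 ≤ x ∧ x ∈ F) :
    ∀ i j, 0 ≤ Amat A B c x i j ∧ Amat A B c x i j ∈ F := by
  rintro (i | i) (j | j)
  · exact hA i j
  · exact hB i j
  · exact hc j
  · exact hx

lemma B0_mem (F : Subfield ℝ) : ∀ i j, 0 ≤ B0 i j ∧ B0 i j ∈ F := by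
  intro i j
  fin_cases i <;> fin_cases j <;> simp [B0, F.one_mem, F.zero_mem]

lemma nnd_upper (F : Subfield ℝ) {m n : ℕ}
    (A : Matrix (Fin m) (Fin n) ℝ) (B : Matrix (Fin m) (Fin 1) ℝ) (c : Fin n → ℝ)
    (x s : ℝ) (hxF : x ∈ F) (hsF : s ∈ F) (h1 : s - 1 ≤ x) (h2 : x ≤ s) (k : ℕ)
    (h : NNDecomp F (Amat A B c x) k) : NNDecomp F (Gmat A B c s) (4 + k) := by
  obtain ⟨u, v, hu, hv, h⟩ := nnd_entry h
  have ht : 0 ≤ s - x ∧ s - x ∈ F := ⟨by linarith, F.sub_mem hsF hxF⟩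
  have ht' : 0 ≤ 1 - (s - x) ∧ 1 - (s - x) ∈ F := ⟨by linarith, F.sub_mem F.one_mem ht.2⟩
  have h0 : (0:ℝ) ≤ 0 ∧ (0:ℝ) ∈ F := ⟨le_rfl, F.zero_mem⟩
  have h1' : (0:ℝ) ≤ 1 ∧ (1:ℝ) ∈ F := ⟨zero_le_one, F.one_mem⟩
  have key := nnd_of_fintype F (ι := Fin 4 ⊕ Fin k) (Gmat A B c s)
    (Sum.elim
      (fun l => Sum.elim (Sum.elim (fun _ => 0)
          (fun _ => if l = 0 ∨ l = 2 then s - x else 1 - (s - x)))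
        (fun i => if i = l then 1 else 0))
      (fun l => Sum.elim (u l) (fun _ => 0)))
    (Sum.elim
      (fun l => Sum.elim (Sum.elim (fun _ => 0) (fun _ => if l = 0 then 1 else 0))
        (fun j => B0 l j))
      (fun l => Sum.elim (v l) (fun _ => 0))) ?_ ?_ ?_
  · simpa using key
  · rintro (l | l) ((i | i) | i)
    · exact h0
    · simp only [Sum.elim_inl, Sum.elim_inr]; split_ifs <;> assumption
    · simp only [Sum.elim_inl, Sum.elim_inr]; split_ifs <;> assumption
    · exact hu _ _
    · exact hu _ _
    · exact h0
  · rintro (l | l) ((i | i) | i)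
    · exact h0
    · simp only [Sum.elim_inl, Sum.elim_inr]; split_ifs <;> assumption
    · exact B0_mem F _ _
    · exact hv _ _
    · exact hv _ _
    · exact h0
  · intro i j
    rw [Fintype.sum_sum_type]
    rcases i with i | i <;> rcases j with j | j
    · simp only [Sum.elim_inl, Sum.elim_inr, ← h i j]
      rcases i with i | i <;> rcases j with j | j
      · simp [Gmat, Amat]
      · simp [Gmat, Amat]
      · simp [Gmat, Amat]
      · simp [Gmat, Amat]
    · rcases i with i | i
      · simp [Gmat, Amat]
      · fin_cases j <;> simp [Gmat, Amat, Fin.sum_univ_four, B0]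
    · rcases j with j | j
      · simp [Gmat, Amat]
      · simp [Gmat, Amat]
    · simp [Gmat]

lemma B0_fool : ∀ i j : Fin 4, i ≠ j → B0 i j = 0 ∨ B0 j i = 0 := by
  intro i j
  fin_cases i <;> fin_cases j <;> simp [B0]

lemma nnd_lower (F : Subfield ℝ) {m n : ℕ}
    (A : Matrix (Fin m) (Fin n) ℝ) (B : Matrix (Fin m) (Fin 1) ℝ) (c : Fin n → ℝ)
    (s : ℝ) (hsF : s ∈ F) (r : ℕ)
    (h : NNDecomp F (Gmat A B c s) r) :
    ∃ x ∈ F, x ∈ Set.Icc (s - 1) s ∧ ∃ k, NNDecomp F (Amat A B c x) k ∧ 4 + k ≤ r := by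
  classical
  obtain ⟨u, v, hu, hv, h⟩ := nnd_entry h
  have hnn : ∀ l i j, 0 ≤ u l i * v l j := fun l i j => mul_nonneg (hu l i).1 (hv l j).1
  have hle : ∀ l i j, u l i * v l j ≤ Gmat A B c s i j := by
    intro l i j
    rw [h i j]
    exact Finset.single_le_sum (f := fun l => u l i * v l j) (fun l _ => hnn l i j)
      (Finset.mem_univ l)
  have hz : ∀ l i j, Gmat A B c s i j = 0 → u l i = 0 ∨ v l j = 0 := by
    intro l i j h0
    have := hle l i j
    rw [h0] at this
    exact mul_eq_zero.1 (le_antisymm this (hnn l i j))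
  let P : Fin r → Prop := fun l => (∃ i, u l (Sum.inr i) ≠ 0) ∧ ∃ j, v l (Sum.inr j) ≠ 0
  -- core terms vanish on the upper rows and the left columns
  have hPu : ∀ l, P l → ∀ i, u l (Sum.inl (Sum.inl i)) = 0 := by
    rintro l ⟨-, j, hj⟩ i
    exact (hz l (Sum.inl (Sum.inl i)) (Sum.inr j) (by simp [Gmat])).resolve_right hj
  have hPv : ∀ l, P l → ∀ j, v l (Sum.inl (Sum.inl j)) = 0 := by
    rintro l ⟨⟨i, hi⟩, -⟩ j
    exact (hz l (Sum.inr i) (Sum.inl (Sum.inl j)) (by simp [Gmat])).resolve_left hi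
  let q : ℝ := ∑ l : {l // P l}, u l (Sum.inl (Sum.inr 0)) * v l (Sum.inl (Sum.inr 0))
  have hq0 : 0 ≤ q := Finset.sum_nonneg fun l _ => hnn _ _ _
  have hqF : q ∈ F := F.sum_mem fun l _ => F.mul_mem (hu _ _).2 (hv _ _).2
  have hsplit : ∀ f : Fin r → ℝ,
      ∑ l, f l = ∑ l : {l // P l}, f l + ∑ l : {l // ¬ P l}, f l := by
    intro f
    exact (Fintype.sum_subtype_add_sum_subtype P f).symm
  have hrest : ∀ i j, Amat A B c (s - q) i j =
      ∑ l : {l // ¬ P l}, u l (Sum.inl i) * v l (Sum.inl j) := by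
    intro i j
    have h1 := h (Sum.inl i) (Sum.inl j)
    rw [hsplit] at h1
    rcases i with i | i
    · have h2 : ∑ l : {l // P l}, u l (Sum.inl (Sum.inl i)) * v l (Sum.inl j) = 0 :=
        Finset.sum_eq_zero fun l _ => by rw [hPu l l.2 i, zero_mul]
      rw [h2, zero_add] at h1
      rw [← h1]
      rcases j with j | j <;> simp [Gmat, Amat]
    · rcases j with j | j
      · have h2 : ∑ l : {l // P l}, u l (Sum.inl (Sum.inr i)) * v l (Sum.inl (Sum.inl j)) = 0 :=
          Finset.sum_eq_zero fun l _ => by rw [hPv l l.2 j, mul_zero]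
        rw [h2, zero_add] at h1
        rw [← h1]
        simp [Gmat, Amat]
      · obtain rfl : i = 0 := Subsingleton.elim _ _
        obtain rfl : j = 0 := Subsingleton.elim _ _
        have h2 : Gmat A B c s (Sum.inl (Sum.inr 0)) (Sum.inl (Sum.inr 0)) = s := by
          simp [Gmat, Amat]
        rw [h2] at h1
        have h3 : Amat A B c (s - q) (Sum.inr 0) (Sum.inr 0) = s - q := by simp [Amat]
        rw [h3]
        change s = q + _ at h1
        linarith
  have hrestd : NNDecomp F (Amat A B c (s - q)) (Fintype.card {l // ¬ P l}) :=
    nnd_of_fintype F _ (fun l i => u l (Sum.inl i)) (fun l j => v l (Sum.inl j))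
      (fun l i => hu _ _) (fun l j => hv _ _) hrest
  have hcard : Fintype.card {l // P l} + Fintype.card {l // ¬ P l} = r := by
    have := Fintype.card_subtype_compl P
    have h2 := Fintype.card_subtype_le P
    rw [Fintype.card_fin] at *
    omega
  have hGB : ∀ i j, Gmat A B c s (Sum.inr i) (Sum.inr j) = B0 i j := fun i j => rfl
  -- the fooling set
  have hf : ∀ i : Fin 4, ∃ l, u l (Sum.inr i) ≠ 0 ∧ v l (Sum.inr i) ≠ 0 := by
    intro i
    by_contra hcon
    push Not at hcon
    have h1 := h (Sum.inr i) (Sum.inr i)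
    rw [Finset.sum_eq_zero] at h1
    · rw [hGB] at h1
      fin_cases i <;> simp [B0] at h1
    · intro l _
      by_cases h0 : u l (Sum.inr i) = 0
      · rw [h0, zero_mul]
      · rw [hcon l h0, mul_zero]
  choose f hfu hfv using hf
  have hfP : ∀ i, P (f i) := fun i => ⟨⟨i, hfu i⟩, ⟨i, hfv i⟩⟩
  have hfool : ∀ i j l, u l (Sum.inr i) ≠ 0 → v l (Sum.inr i) ≠ 0 → u l (Sum.inr j) ≠ 0 →
      v l (Sum.inr j) ≠ 0 → i = j := by
    intro i j l h1 h2 h3 h4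
    by_contra hij
    rcases B0_fool i j hij with h0 | h0
    · rcases hz l (Sum.inr i) (Sum.inr j) (by rw [hGB, h0]) with h5 | h5 <;> contradiction
    · rcases hz l (Sum.inr j) (Sum.inr i) (by rw [hGB, h0]) with h5 | h5 <;> contradiction
  let g : Fin 4 → {l // P l} := fun i => ⟨f i, hfP i⟩
  have hg : Function.Injective g := by
    intro i j hij
    have hij' : f i = f j := congrArg Subtype.val hij
    exact hfool i j (f i) (hfu i) (hfv i) (hij' ▸ hfu j) (hij' ▸ hfv j)
  have h4 : 4 ≤ Fintype.card {l // P l} := by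
    simpa using Fintype.card_le_of_injective g hg
  by_cases hq1 : q ≤ 1
  · exact ⟨s - q, F.sub_mem hsF hqF, ⟨by linarith, by linarith⟩, _, hrestd, by omega⟩
  push Not at hq1
  have h5 : 5 ≤ Fintype.card {l // P l} := by
    by_contra hlt
    have hc4 : Fintype.card (Fin 4) = Fintype.card {l // P l} := by
      rw [Fintype.card_fin]; omega
    have hbij : Function.Bijective g := (Fintype.bijective_iff_injective_and_card g).2 ⟨hg, hc4⟩
    have hqeq : q = u (f 0) (Sum.inl (Sum.inr 0)) * v (f 0) (Sum.inl (Sum.inr 0)) := by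
      have : q = ∑ i, u (g i) (Sum.inl (Sum.inr 0)) * v (g i) (Sum.inl (Sum.inr 0)) :=
        (hbij.sum_comp (fun l : {l // P l} =>
          u l (Sum.inl (Sum.inr 0)) * v l (Sum.inl (Sum.inr 0)))).symm
      rw [this, Finset.sum_eq_single 0]
      · intro i _ hi
        have := (hz (f i) (Sum.inr i) (Sum.inl (Sum.inr 0)) (by simp [Gmat, hi])).resolve_left
          (hfu i)
        change u (f i) _ * v (f i) _ = 0
        rw [this, mul_zero]
      · simp
    have h11 : u (f 0) (Sum.inr 0) * v (f 0) (Sum.inr 0) = 1 := by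
      have h1 := h (Sum.inr 0) (Sum.inr 0)
      rw [Finset.sum_eq_single (f 0)] at h1
      · rw [← h1, hGB]; simp [B0]
      · intro l _ hl
        by_contra hne
        have hu0 := left_ne_zero_of_mul hne
        have hv0 := right_ne_zero_of_mul hne
        obtain ⟨i, hi⟩ := hbij.2 ⟨l, ⟨0, hu0⟩, ⟨0, hv0⟩⟩
        have hi' : f i = l := congrArg Subtype.val hi
        have : i = 0 := hfool i 0 l (hi' ▸ hfu i) (hi' ▸ hfv i) hu0 hv0
        exact hl (by rw [← hi', this])
      · simp
    have hp1 : u (f 0) (Sum.inl (Sum.inr 0)) * v (f 0) (Sum.inr 0) ≤ 1 := by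
      have := hle (f 0) (Sum.inl (Sum.inr 0)) (Sum.inr 0)
      simpa [Gmat] using this
    have hB1 : u (f 0) (Sum.inr 0) * v (f 0) (Sum.inl (Sum.inr 0)) ≤ 1 := by
      have := hle (f 0) (Sum.inr 0) (Sum.inl (Sum.inr 0))
      simpa [Gmat] using this
    have hvpos : 0 < v (f 0) (Sum.inr 0) := lt_of_le_of_ne (hv _ _).1 (hfv 0).symm
    have hup : u (f 0) (Sum.inl (Sum.inr 0)) ≤ u (f 0) (Sum.inr 0) :=
      le_of_mul_le_mul_right (by rw [h11]; exact hp1) hvpos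
    have := mul_le_mul_of_nonneg_right hup (hv (f 0) (Sum.inl (Sum.inr 0))).1
    linarith
  refine ⟨s - 1, F.sub_mem hsF F.one_mem, ⟨le_rfl, by linarith⟩,
    Fintype.card {l // ¬ P l} + 1, ?_, by omega⟩
  have key := nnd_of_fintype F (ι := {l // ¬ P l} ⊕ Fin 1) (Amat A B c (s - 1))
    (Sum.elim (fun l i => u l (Sum.inl i)) (fun _ => Sum.elim (fun _ => 0) (fun _ => 1)))
    (Sum.elim (fun l j => v l (Sum.inl j)) (fun _ => Sum.elim (fun _ => 0) (fun _ => q - 1)))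
    ?_ ?_ ?_
  · rwa [Fintype.card_sum, Fintype.card_fin] at key
  · rintro (l | l) i
    · exact hu _ _
    · rcases i with i | i
      · exact ⟨le_rfl, F.zero_mem⟩
      · exact ⟨zero_le_one, F.one_mem⟩
  · rintro (l | l) i
    · exact hv _ _
    · rcases i with i | i
      · exact ⟨le_rfl, F.zero_mem⟩
      · exact ⟨by simp only [Sum.elim_inr]; linarith, F.sub_mem hqF F.one_mem⟩
  · intro i j
    rw [Fintype.sum_sum_type]
    simp only [Sum.elim_inl, Sum.elim_inr, ← hrest i j]
    rcases i with i | i <;> rcases j with j | j <;> simp [Amat]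

theorem stmt3 (F : Subfield ℝ) (m n : ℕ)
    (A : Matrix (Fin m) (Fin n) ℝ) (B : Matrix (Fin m) (Fin 1) ℝ) (c : Fin n → ℝ)
    (hA : ∀ i j, 0 ≤ A i j ∧ A i j ∈ F) (hB : ∀ i j, 0 ≤ B i j ∧ B i j ∈ F)
    (hc : ∀ j, 0 ≤ c j ∧ c j ∈ F)
    (s : ℕ) (hs : 0 < s) :
    nnRank F (Gmat A B c (s : ℝ)) =
      4 + sInf {t | ∃ ξ : ℝ, ξ ∈ F ∧ ξ ∈ Set.Icc ((s : ℝ) - 1) (s : ℝ) ∧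
            nnRank F (Amat A B c ξ) = t} := by
  have hs1 : (1 : ℝ) ≤ s := by exact_mod_cast hs
  have hsF : (s : ℝ) ∈ F := natCast_mem F s
  have hup : NNDecomp F (Gmat A B c (s : ℝ)) (4 + sInf {t | ∃ ξ : ℝ, ξ ∈ F ∧
      ξ ∈ Set.Icc ((s : ℝ) - 1) (s : ℝ) ∧ nnRank F (Amat A B c ξ) = t}) := by
    have hne : {t | ∃ ξ : ℝ, ξ ∈ F ∧ ξ ∈ Set.Icc ((s : ℝ) - 1) (s : ℝ) ∧
        nnRank F (Amat A B c ξ) = t}.Nonempty :=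
      ⟨_, s, hsF, ⟨by linarith, le_rfl⟩, rfl⟩
    obtain ⟨x, hxF, hx, hxe⟩ := Nat.sInf_mem hne
    rw [← hxe]
    refine nnd_upper F A B c x s hxF hsF hx.1 hx.2 _ ?_
    exact Nat.sInf_mem (nnd_exists F _
      (amat_nonneg F A B c hA hB hc x ⟨by linarith [hx.1], hxF⟩))
  apply le_antisymm
  · exact Nat.sInf_le hup
  · have hmem : NNDecomp F (Gmat A B c (s : ℝ)) (nnRank F (Gmat A B c (s : ℝ))) :=
      Nat.sInf_mem (s := {k | NNDecomp F (Gmat A B c (s : ℝ)) k}) ⟨_, hup⟩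
    obtain ⟨x, hxF, hx, k, hk, hkr⟩ := nnd_lower F A B c s hsF _ hmem
    have h1 : nnRank F (Amat A B c x) ≤ k := Nat.sInf_le hk
    have h2 : sInf {t | ∃ ξ : ℝ, ξ ∈ F ∧ ξ ∈ Set.Icc ((s : ℝ) - 1) (s : ℝ) ∧
        nnRank F (Amat A B c ξ) = t} ≤ nnRank F (Amat A B c x) :=
      Nat.sInf_le ⟨x, hxF, hx, rfl⟩
    omega
end

section
/- Let ℳ be the explicit 21×21 nonnegative integer matrix of the paper (defined row-by-row as in the statement of the reduction to C(a,b,c,d)). Then ℳ can be written as a sum of 19 nonnegative rank-one real matrices; that is, rank_{ℝ+} ℳ ≤ 19. -/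
/-- The explicit 21 × 21 matrix ℳ of the paper. -/
def Mcal (K : Type*) [Zero K] [One K] [OfNat K 2] : Matrix (Fin 21) (Fin 21) K :=
  Matrix.of
    ![![2,2,2,1,0,0,0,0,0,0,0,0,0,0,0,0,0,1,1,1,1],
      ![1,2,1,0,1,0,0,0,0,0,0,0,0,0,0,0,0,0,0,0,0],
      ![0,0,1,2,0,0,0,0,0,0,0,0,0,1,1,1,1,0,0,0,0],
      ![0,1,0,0,2,0,0,0,0,1,1,1,1,0,0,0,0,0,0,0,0],
      ![0,1,1,2,2,1,1,1,1,0,0,0,0,0,0,0,0,0,0,0,0],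
      ![0,0,0,1,1,1,1,0,0,0,0,0,0,0,0,0,0,0,0,0,0],
      ![0,0,0,0,0,0,1,1,0,0,0,0,0,0,0,0,0,0,0,0,0],
      ![0,0,0,0,0,0,0,1,1,0,0,0,0,0,0,0,0,0,0,0,0],
      ![0,0,0,0,0,1,0,0,1,0,0,0,0,0,0,0,0,0,0,0,0],
      ![0,0,0,0,1,0,0,0,0,1,1,0,0,0,0,0,0,0,0,0,0],
      ![0,0,0,0,0,0,0,0,0,0,1,1,0,0,0,0,0,0,0,0,0],
      ![0,0,0,0,0,0,0,0,0,0,0,1,1,0,0,0,0,0,0,0,0],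
      ![0,0,0,0,0,0,0,0,0,1,0,0,1,0,0,0,0,0,0,0,0],
      ![0,0,0,1,0,0,0,0,0,0,0,0,0,1,1,0,0,0,0,0,0],
      ![0,0,0,0,0,0,0,0,0,0,0,0,0,0,1,1,0,0,0,0,0],
      ![0,0,0,0,0,0,0,0,0,0,0,0,0,0,0,1,1,0,0,0,0],
      ![0,0,0,0,0,0,0,0,0,0,0,0,0,1,0,0,1,0,0,0,0],
      ![1,0,0,0,0,0,0,0,0,0,0,0,0,0,0,0,0,1,1,0,0],
      ![0,0,0,0,0,0,0,0,0,0,0,0,0,0,0,0,0,0,1,1,0],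
      ![0,0,0,0,0,0,0,0,0,0,0,0,0,0,0,0,0,0,0,1,1],
      ![0,0,0,0,0,0,0,0,0,0,0,0,0,0,0,0,0,1,0,0,1]]

/-- Twice the left factors, over `ℤ[√2]`. The first 16 pieces are the rows of the cyclic blocks,
the last 3 form a nonnegative factorization of the remaining 5 × 5 matrix of rank 3. -/
def facU (l : Fin 19) (i : Fin 21) : ℤ√2 :=
  if l.val < 16 then
    if i.val = l.val + 5 then ⟨2, 0⟩
    else if l.val < 4 ∧ i.val = 4 ∨ 4 ≤ l.val ∧ l.val < 8 ∧ i.val = 3 ∨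
        8 ≤ l.val ∧ l.val < 12 ∧ i.val = 2 then
      (if l.val % 2 = 0 then ⟨2, -1⟩ else ⟨0, 1⟩)
    else if 12 ≤ l.val ∧ i.val = 0 then
      (if l.val % 2 = 0 then ⟨4, -2⟩ else ⟨-2, 2⟩)
    else ⟨0, 0⟩
  else if l.val = 16 then
    if i.val = 0 then ⟨0, 2⟩ else if i.val = 1 then ⟨2, 0⟩ else ⟨0, 0⟩
  else if l.val = 17 then
    if i.val = 0 then ⟨2, 0⟩ else if i.val = 2 ∨ i.val = 4 then ⟨2, 1⟩ else ⟨0, 0⟩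
  else
    if i.val = 1 then ⟨2, 0⟩ else if i.val = 3 ∨ i.val = 4 then ⟨2, 1⟩ else ⟨0, 0⟩

/-- The right factors, over `ℤ[√2]`. -/
def facV (l : Fin 19) (j : Fin 21) : ℤ√2 :=
  if h : l.val < 16 then ⟨Mcal ℤ ⟨l.val + 5, by omega⟩ j, 0⟩
  else if l.val = 16 then
    if j.val = 0 ∨ j.val = 2 then ⟨1, 0⟩ else if j.val = 1 then ⟨0, 1⟩ else ⟨0, 0⟩
  else if l.val = 17 then
    if j.val = 2 then ⟨2, -1⟩ else if j.val = 3 then ⟨1, 0⟩ else ⟨0, 0⟩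
  else
    if j.val = 1 then ⟨2, -1⟩ else if j.val = 4 then ⟨1, 0⟩ else ⟨0, 0⟩

/-- The embedding of `ℤ[√2]` in `ℝ`. -/
noncomputable def embR : ℤ√2 →+* ℝ :=
  Zsqrtd.lift ⟨Real.sqrt 2, by norm_num⟩

theorem embR_mk (a b : ℤ) : embR ⟨a, b⟩ = a + b * Real.sqrt 2 := rfl

/-- The values occurring in the factors. -/
def facVals : List (ℤ√2) :=
  [⟨0, 0⟩, ⟨1, 0⟩, ⟨2, 0⟩, ⟨2, -1⟩, ⟨0, 1⟩, ⟨4, -2⟩, ⟨-2, 2⟩, ⟨0, 2⟩, ⟨2, 1⟩]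

theorem embR_nonneg (x : ℤ√2) (hx : x ∈ facVals) : 0 ≤ embR x := by
  have h1 : 1 ≤ Real.sqrt 2 := Real.one_le_sqrt.mpr (by norm_num)
  have h2 : Real.sqrt 2 ≤ 2 := Real.sqrt_le_iff.mpr (by norm_num)
  simp only [facVals, List.mem_cons, List.not_mem_nil, or_false] at hx
  rcases hx with h | h | h | h | h | h | h | h | h <;> subst h <;> rw [embR_mk] <;>
    push_cast <;> linarith

theorem facU_mem : ∀ l i, facU l i ∈ facVals := by decide +kernel

theorem facV_mem : ∀ l j, facV l j ∈ facVals := by decide +kernel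

theorem fac_eq : ∀ i j, ∑ l, facU l i * facV l j = 2 * ((Mcal ℤ i j : ℤ) : ℤ√2) := by
  decide +kernel

set_option maxHeartbeats 4000000 in
theorem Mcal_cast (i j : Fin 21) : Mcal ℝ i j = ((Mcal ℤ i j : ℤ) : ℝ) := by
  fin_cases i <;> fin_cases j <;> simp [Mcal]

theorem stmt11 :
    NNDecomp ⊤ (Mcal ℝ) 19 ∧ nnRank ⊤ (Mcal ℝ) ≤ 19 := by
  have key : NNDecomp ⊤ (Mcal ℝ) 19 := by
    refine ⟨fun l i => embR (facU l i) / 2, fun l j => embR (facV l j), ?_, ?_, ?_⟩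
    · intro l i
      exact ⟨div_nonneg (embR_nonneg _ (facU_mem l i)) (by norm_num), Subfield.mem_top _⟩
    · intro l j
      exact ⟨embR_nonneg _ (facV_mem l j), Subfield.mem_top _⟩
    · ext i j
      have h := congrArg embR (fac_eq i j)
      rw [map_sum, map_mul, map_intCast, map_ofNat, ← Mcal_cast] at h
      simp only [map_mul] at h
      rw [Matrix.sum_apply]
      simp only [Matrix.vecMulVec_apply, div_mul_eq_mul_div]
      rw [← Finset.sum_div, h]
      ring
  exact ⟨key, Nat.sInf_le key⟩
end
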